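/- Let I⃗ = Glob({*}) be the directed segment, and let I⃗*I⃗ be the flow with 0-skeleton {0,1,2} and path space the three-point discrete space {u, w, u*w}, where s(u)=0, t(u)=1, s(w)=1, t(w)=2, and u*w is the composite with s(u*w)=0, t(u*w)=2. Then the branching space P⁻(I⃗) is a one-point space, while the branching space P⁻(I⃗*I⃗) is a discrete two-point space (the two classes being {u, u*w} and {w}). In particular, the morphism of flows φ : I⃗ → I⃗*I⃗ sending the unique path of I⃗ to u*w does not induce a bijection between the path components of P⁻(I⃗) and those of P⁻(I⃗*I⃗). -/

import Mathlib

set_option maxHeartbeats 1000000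

/-- A flow: a topological space of non-constant execution paths over a discrete
`0`-skeleton of states, with a continuous associative partial composition law.
(Discreteness of the `0`-skeleton is encoded by requiring the fibers of the
source and target maps to be open, i.e. `s` and `t` are continuous into the
discrete space of states.) -/
structure GFlow where
  States : Type
  Paths : Type
  [top : TopologicalSpace Paths]
  s : Paths → States
  t : Paths → States
  isOpen_sFiber : ∀ α : States, IsOpen {x : Paths | s x = α}
  isOpen_tFiber : ∀ α : States, IsOpen {x : Paths | t x = α}
  comp : (x y : Paths) → t x = s y → Paths
  continuous_comp : Continuous fun p : {p : Paths × Paths // t p.1 = s p.2} =>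
    comp p.1.1 p.1.2 p.2
  s_comp : ∀ x y h, s (comp x y h) = s x
  t_comp : ∀ x y h, t (comp x y h) = t y
  comp_assoc : ∀ x y z (hxy : t x = s y) (hyz : t y = s z)
    (h₁ : t (comp x y hxy) = s z) (h₂ : t x = s (comp y z hyz)),
    comp (comp x y hxy) z h₁ = comp x (comp y z hyz) h₂

attribute [instance] GFlow.top

/-- A morphism of flows. -/
structure FlowHom (X Y : GFlow) where
  f0 : X.States → Y.States
  pf : X.Paths → Y.Paths
  continuous_pf : Continuous pf
  s_pf : ∀ x, Y.s (pf x) = f0 (X.s x)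
  t_pf : ∀ x, Y.t (pf x) = f0 (X.t x)
  comp_pf : ∀ x y (h : X.t x = X.s y) (h' : Y.t (pf x) = Y.s (pf y)),
    pf (X.comp x y h) = Y.comp (pf x) (pf y) h'

/-- Composition of morphisms of flows. -/
def FlowHom.compHom {X Y Z : GFlow} (g : FlowHom Y Z) (f : FlowHom X Y) : FlowHom X Z where
  f0 := g.f0 ∘ f.f0
  pf := g.pf ∘ f.pf
  continuous_pf := g.continuous_pf.comp f.continuous_pf
  s_pf := fun x => by simp [Function.comp, g.s_pf, f.s_pf]
  t_pf := fun x => by simp [Function.comp, g.t_pf, f.t_pf]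
  comp_pf := fun x y h h' => by
    have h1 : Y.t (f.pf x) = Y.s (f.pf y) := by rw [f.t_pf, f.s_pf, h]
    have h2 : Z.t (g.pf (f.pf x)) = Z.s (g.pf (f.pf y)) := by rw [g.t_pf, g.s_pf, h1]
    simp only [Function.comp]
    rw [f.comp_pf x y h h1, g.comp_pf _ _ h1 h2]

/-- The identity morphism of a flow. -/
def FlowHom.id (X : GFlow) : FlowHom X X where
  f0 := fun α => α
  pf := fun x => x
  continuous_pf := continuous_id
  s_pf := fun _ => rfl
  t_pf := fun _ => rfl
  comp_pf := fun _ _ _ _ => rfl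
/-- The globe of a topological space `Z`: two states `false = 0` and `true = 1`,
path space `Z`, no composable pairs of paths. -/
def Glob (Z : Type) [TopologicalSpace Z] : GFlow where
  States := Bool
  Paths := Z
  s := fun _ => false
  t := fun _ => true
  isOpen_sFiber := fun α => by
    cases α
    · have : {x : Z | false = false} = Set.univ := by ext x; simp
      rw [this]; exact isOpen_univ
    · have : {x : Z | false = true} = (∅ : Set Z) := by ext x; simp
      rw [this]; exact isOpen_empty
  isOpen_tFiber := fun α => by
    cases α
    · have : {x : Z | true = false} = (∅ : Set Z) := by ext x; simp
      rw [this]; exact isOpen_empty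
    · have : {x : Z | true = true} = Set.univ := by ext x; simp
      rw [this]; exact isOpen_univ
  comp := fun _ _ h => absurd h (fun hh => Bool.noConfusion hh)
  continuous_comp := continuous_iff_continuousAt.2 fun p => absurd p.2 (fun hh => Bool.noConfusion hh)
  s_comp := fun _ _ h => absurd h (fun hh => Bool.noConfusion hh)
  t_comp := fun _ _ h => absurd h (fun hh => Bool.noConfusion hh)
  comp_assoc := fun _ _ _ hxy => absurd hxy (fun hh => Bool.noConfusion hh)

/-- The morphism of flows induced between globes by a continuous map. -/
def GlobMap {Z Z' : Type} [TopologicalSpace Z] [TopologicalSpace Z'] (g : C(Z, Z')) :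
    FlowHom (Glob Z) (Glob Z') where
  f0 := fun b => b
  pf := g
  continuous_pf := g.continuous
  s_pf := fun _ => rfl
  t_pf := fun _ => rfl
  comp_pf := fun _ _ h => absurd h (fun hh => Bool.noConfusion hh)
/-- A relation is a "closed equivalence relation compatible with branchings" if it is an
equivalence relation whose graph is closed and which identifies `x` with `x * y`. -/
def IsBranchCompatRel (X : GFlow) (r : X.Paths → X.Paths → Prop) : Prop :=
  Equivalence r ∧ IsClosed {p : X.Paths × X.Paths | r p.1 p.2} ∧
    ∀ x y (h : X.t x = X.s y), r x (X.comp x y h)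

/-- The smallest closed equivalence relation containing all pairs `(x, x * y)`. -/
def BranchRel (X : GFlow) (a b : X.Paths) : Prop :=
  ∀ r, IsBranchCompatRel X r → r a b

/-- The setoid underlying the branching space. -/
def branchSetoid (X : GFlow) : Setoid X.Paths :=
  ⟨BranchRel X, ⟨fun a _ hr => hr.1.refl a, fun h r hr => hr.1.symm (h r hr),
    fun h1 h2 r hr => hr.1.trans (h1 r hr) (h2 r hr)⟩⟩

/-- The branching space of a flow: the quotient of the path space by the smallest
closed equivalence relation identifying `x` and `x * y`. -/
def BranchSpace (X : GFlow) : Type :=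
  Quotient (branchSetoid X)

instance (X : GFlow) : TopologicalSpace (BranchSpace X) :=
  inferInstanceAs (TopologicalSpace (Quotient (branchSetoid X)))

/-- The canonical map `h⁻` from the path space to the branching space. -/
def hminus (X : GFlow) : X.Paths → BranchSpace X :=
  Quotient.mk (branchSetoid X)

theorem continuous_hminus (X : GFlow) : Continuous (hminus X) :=
  continuous_quotient_mk'

theorem BranchRel.map {X Y : GFlow} (f : FlowHom X Y) {a b : X.Paths}
    (h : BranchRel X a b) : BranchRel Y (f.pf a) (f.pf b) := by
  intro r hr
  refine h (fun u v => r (f.pf u) (f.pf v))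
    ⟨⟨fun u => hr.1.refl _, fun h' => hr.1.symm h', fun h1 h2 => hr.1.trans h1 h2⟩, ?_, ?_⟩
  · have : {p : X.Paths × X.Paths | r (f.pf p.1) (f.pf p.2)} =
        (Prod.map f.pf f.pf) ⁻¹' {q : Y.Paths × Y.Paths | r q.1 q.2} := rfl
    rw [this]
    exact hr.2.1.preimage (f.continuous_pf.prodMap f.continuous_pf)
  · intro x y hxy
    have h' : Y.t (f.pf x) = Y.s (f.pf y) := by rw [f.t_pf, f.s_pf, hxy]
    rw [f.comp_pf x y hxy h']
    exact hr.2.2 _ _ h'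

/-- The map induced on branching spaces by a morphism of flows. -/
def branchMap {X Y : GFlow} (f : FlowHom X Y) : BranchSpace X → BranchSpace Y :=
  Quotient.map' f.pf (fun _ _ h => h.map f)

theorem continuous_branchMap {X Y : GFlow} (f : FlowHom X Y) :
    Continuous (branchMap f) :=
  f.continuous_pf.quotient_map' _

/-- The map induced on branching spaces, as a continuous map. -/
def branchCMap {X Y : GFlow} (f : FlowHom X Y) : C(BranchSpace X, BranchSpace Y) :=
  ⟨branchMap f, continuous_branchMap f⟩
open Topology in
/-- The map induced by a continuous map on path components. -/
def zerothMap {A B : Type} [TopologicalSpace A] [TopologicalSpace B] (f : C(A, B)) :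
    ZerothHomotopy A → ZerothHomotopy B :=
  Quot.map f (fun _ _ h => Nonempty.map (fun γ => γ.map f.continuous) h)

open Topology in
/-- The map induced by a continuous map on homotopy "groups" (sets of homotopy classes of
generalized loops rel boundary). -/
def piMap (N : Type) {A B : Type} [TopologicalSpace A] [TopologicalSpace B] (f : C(A, B))
    (a : A) : HomotopyGroup N A a → HomotopyGroup N B (f a) :=
  Quot.map
    (fun p => (⟨f.comp p.1, fun y hy => by simp [p.2 y hy]⟩ : GenLoop N B (f a)))
    (fun p q h => Nonempty.map (fun (F : p.1.HomotopyRel q.1 (Cube.boundary N)) =>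
      F.compContinuousMap f) h)

/-- A continuous map is a weak homotopy equivalence when it induces a bijection on path
components and isomorphisms on all homotopy groups at every basepoint. -/
def IsWeakHomotopyEquiv {A B : Type} [TopologicalSpace A] [TopologicalSpace B]
    (f : C(A, B)) : Prop :=
  Function.Bijective (zerothMap f) ∧
  ∀ (n : ℕ) (a : A), Function.Bijective (piMap (Fin (n + 1)) f a)
/-- The directed segment `I⃗ = Glob({*})`. -/
def Iseg : GFlow := Glob Unit

/-- The flow `I⃗*I⃗`: states `{0,1,2}`, paths `u = 0`, `w = 1` and the composite
`u*w = 2`, with `s(u)=0, t(u)=1, s(w)=1, t(w)=2, s(u*w)=0, t(u*w)=2`. -/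
def IsegIseg : GFlow where
  States := Fin 3
  Paths := Fin 3
  s := ![0, 1, 0]
  t := ![1, 2, 2]
  isOpen_sFiber := fun _ => isOpen_discrete _
  isOpen_tFiber := fun _ => isOpen_discrete _
  comp := fun _ _ _ => 2
  continuous_comp := continuous_const
  s_comp := by decide
  t_comp := by decide
  comp_assoc := fun _ _ _ _ _ _ _ => rfl

/-- The path `u` of `I⃗*I⃗`. -/
def pathu : IsegIseg.Paths := (0 : Fin 3)
/-- The path `w` of `I⃗*I⃗`. -/
def pathw : IsegIseg.Paths := (1 : Fin 3)
/-- The composite path `u*w` of `I⃗*I⃗`. -/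
def pathuw : IsegIseg.Paths := (2 : Fin 3)

/-- The morphism of flows `φ : I⃗ → I⃗*I⃗` dividing the directed segment in two, i.e.
sending the unique non-constant path of `I⃗` to the composite `u*w`. -/
def phiSubdiv : FlowHom Iseg IsegIseg where
  f0 := fun b => cond b ((2 : Fin 3)) ((0 : Fin 3))
  pf := fun _ => pathuw
  continuous_pf := continuous_const
  s_pf := fun _ => rfl
  t_pf := fun _ => rfl
  comp_pf := fun _ _ h => absurd h (fun hh => Bool.noConfusion hh)

theorem hminus_comp (X : GFlow) (x y : X.Paths) (h : X.t x = X.s y) :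
    hminus X (X.comp x y h) = hminus X x :=
  Quotient.sound fun _ hr => hr.1.symm (hr.2.2 x y h)

theorem isBranchCompatRel_s_eq (X : GFlow) :
    IsBranchCompatRel X fun a b => X.s a = X.s b := by
  refine ⟨⟨fun _ => rfl, Eq.symm, Eq.trans⟩, ?_, fun x y h => (X.s_comp x y h).symm⟩
  let _ : TopologicalSpace X.States := ⊥
  have : DiscreteTopology X.States := ⟨rfl⟩
  have hs : Continuous X.s := continuous_discrete_rng.2 X.isOpen_sFiber
  exact isClosed_eq (hs.comp continuous_fst) (hs.comp continuous_snd)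

theorem s_eq_of_hminus_eq {X : GFlow} {a b : X.Paths} (h : hminus X a = hminus X b) :
    X.s a = X.s b :=
  Quotient.exact h _ (isBranchCompatRel_s_eq X)

theorem discreteTopology_branchSpace (X : GFlow) [DiscreteTopology X.Paths] :
    DiscreteTopology (BranchSpace X) :=
  discreteTopology_iff_forall_isOpen.2 fun s =>
    isOpen_coinduced.2 (isOpen_discrete (hminus X ⁻¹' s))

theorem zerothHomotopy_mk_injective (A : Type) [TopologicalSpace A] [TotallyDisconnectedSpace A] :
    Function.Injective (Quotient.mk (pathSetoid A)) := by
  intro a b h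
  obtain ⟨γ⟩ : Joined a b := Quotient.exact h
  have := (isPreconnected_range γ.continuous).subsingleton
    ⟨0, γ.source⟩ ⟨1, γ.target⟩
  exact this

instance : DiscreteTopology IsegIseg.Paths :=
  inferInstanceAs (DiscreteTopology (Fin 3))

theorem hminus_pathu_eq_pathuw : hminus IsegIseg pathu = hminus IsegIseg pathuw :=
  (hminus_comp IsegIseg pathu pathw rfl).symm

theorem hminus_pathu_ne_pathw : hminus IsegIseg pathu ≠ hminus IsegIseg pathw := fun h =>
  zero_ne_one (α := Fin 3) (s_eq_of_hminus_eq h)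

theorem not_surjective_zerothMap_phiSubdiv :
    ¬ Function.Surjective (zerothMap (branchCMap phiSubdiv)) := by
  intro h
  have := discreteTopology_branchSpace IsegIseg
  obtain ⟨⟨⟨x⟩⟩, hx⟩ := h (Quotient.mk _ (hminus IsegIseg pathw))
  have huw : hminus IsegIseg pathuw = hminus IsegIseg pathw :=
    zerothHomotopy_mk_injective _ hx
  exact hminus_pathu_ne_pathw (hminus_pathu_eq_pathuw.trans huw)

/-- `P⁻(I⃗)` is a one-point space; `P⁻(I⃗*I⃗)` is a discrete two-point space, the two
classes being `{u, u*w}` and `{w}`; and the subdivision morphism `φ : I⃗ → I⃗*I⃗` does not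
induce a bijection between the path components of `P⁻(I⃗)` and those of `P⁻(I⃗*I⃗)`. -/
theorem branch_space_of_subdivided_segment :
    (Nonempty (BranchSpace Iseg) ∧ Subsingleton (BranchSpace Iseg)) ∧
    (hminus IsegIseg pathu = hminus IsegIseg pathuw ∧
      hminus IsegIseg pathu ≠ hminus IsegIseg pathw ∧
      (∀ q : BranchSpace IsegIseg, q = hminus IsegIseg pathu ∨ q = hminus IsegIseg pathw) ∧
      DiscreteTopology (BranchSpace IsegIseg)) ∧
    ¬ Function.Bijective (zerothMap (branchCMap phiSubdiv)) := by
  refine ⟨⟨⟨hminus Iseg ()⟩, ⟨?_⟩⟩, ⟨hminus_pathu_eq_pathuw, hminus_pathu_ne_pathw, ?_,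
    discreteTopology_branchSpace IsegIseg⟩, fun h => not_surjective_zerothMap_phiSubdiv h.2⟩
  · rintro ⟨⟨⟩⟩ ⟨⟨⟩⟩
    rfl
  · intro q
    obtain ⟨x, rfl⟩ : ∃ x, hminus IsegIseg x = q := Quotient.exists_rep q
    change Fin 3 at x
    fin_cases x
    · exact Or.inl rfl
    · exact Or.inr rfl
    · exact Or.inl hminus_pathu_eq_pathuw.symm
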